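/- arXiv:2407.04878 — 2 statements merged into one kernel-verified Lean document; each statement's English description precedes it below -/
import Mathlib

section
/- The topological space (M(I), ϑ) of regular nonnegative [0,∞]-valued measures on an open interval I is sequentially compact: every sequence has a subsequence converging in ϑ. -/
open MeasureTheory Set ENNReal Topology Filter TopologicalSpace

noncomputable section

/-- A nonnegative `[0,∞]`-valued Borel measure is *regular* if it is outer regular over
open sets and inner regular over compact sets. -/
def IsRegularM {X : Type*} [TopologicalSpace X] [MeasurableSpace X] (m : Measure X) : Prop :=
  (∀ A : Set X, MeasurableSet A → m A = ⨅ (U : Set X) (_ : IsOpen U ∧ A ⊆ U), m U) ∧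
  (∀ A : Set X, MeasurableSet A → m A = ⨆ (K : Set X) (_ : IsCompact K ∧ K ⊆ A), m K)

/-- The explosion set `e(m)`: points all of whose neighborhoods have infinite measure. -/
def explosionSet (I : Set ℝ) (m : Measure ↥I) : Set ↥I :=
  {x | ∀ ε : ℝ, 0 < ε → m {y : ↥I | |(y : ℝ) - (x : ℝ)| < ε} = ∞}

/-- The open interval `(a,b)` of `I`. -/
def IooI (I : Set ℝ) (a b : ℝ) : Set ↥I := {y : ↥I | a < (y : ℝ) ∧ (y : ℝ) < b}

/-- The compact interval `[a,b]` of `I`. -/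
def IccI (I : Set ℝ) (a b : ℝ) : Set ↥I := {y : ↥I | a ≤ (y : ℝ) ∧ (y : ℝ) ≤ b}

/-- The topology `ϑ`: the coarsest topology on measures over `I` such that
`m ↦ m((a,b))` is lower semicontinuous and `m ↦ m([a,b])` is upper semicontinuous for
rational `a, b ∈ I`.  It is generated by the subbasic sets `{m | m((a,b)) > c}` and
`{m | m([a,b]) < d}`. -/
instance thetaTop (I : Set ℝ) : TopologicalSpace (Measure ↥I) :=
  TopologicalSpace.generateFrom
    ({U | ∃ (a b : ℚ) (c : ℝ≥0∞), (a : ℝ) ∈ I ∧ (b : ℝ) ∈ I ∧ (a : ℝ) < b ∧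
        U = {m : Measure ↥I | c < m (IooI I a b)}} ∪
     {U | ∃ (a b : ℚ) (d : ℝ≥0∞), (a : ℝ) ∈ I ∧ (b : ℝ) ∈ I ∧ (a : ℝ) ≤ b ∧
        U = {m : Measure ↥I | m (IccI I a b) < d}})

/-- The space `M(I)` of regular nonnegative `[0,∞]`-valued measures on `I`,
with the subspace topology inherited from `ϑ`. -/
abbrev MSpace (I : Set ℝ) : Type := {m : Measure ↥I // IsRegularM m}

/-- The inner extension to arbitrary sets of a set function on compact sets. -/
def innerExtension {X : Type*} [TopologicalSpace X] (Λ : Set X → ℝ≥0∞) (U : Set X) : ℝ≥0∞ :=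
  ⨆ (K : Set X) (_ : IsCompact K ∧ K ⊆ U), Λ K

theorem le_innerExtension {X : Type*} [TopologicalSpace X] (Λ : Set X → ℝ≥0∞) {K U : Set X}
    (hK : IsCompact K) (hKU : K ⊆ U) : Λ K ≤ innerExtension Λ U :=
  le_iSup₂_of_le K ⟨hK, hKU⟩ le_rfl

theorem innerExtension_mono {X : Type*} [TopologicalSpace X] (Λ : Set X → ℝ≥0∞) {U V : Set X}
    (hUV : U ⊆ V) : innerExtension Λ U ≤ innerExtension Λ V :=
  iSup₂_le fun _ hK => le_innerExtension Λ hK.1 (hK.2.trans hUV)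

theorem innerExtension_iUnion_le {X : Type*} [TopologicalSpace X] [T2Space X]
    {Λ : Set X → ℝ≥0∞} (h_empty : Λ ∅ = 0) (h_union : ∀ s t, Λ (s ∪ t) ≤ Λ s + Λ t)
    {U : ℕ → Set X} (hU : ∀ i, IsOpen (U i)) :
    innerExtension Λ (⋃ i, U i) ≤ ∑' i, innerExtension Λ (U i) := by
  refine iSup₂_le fun K hK => ?_
  obtain ⟨t, ht⟩ := hK.1.elim_finite_subcover U hU hK.2
  obtain ⟨L, hLc, hLU, hKL⟩ := hK.1.finite_compact_cover t U (fun i _ => hU i) ht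
  have h_sum : ∀ t : Finset ℕ, Λ (⋃ i ∈ t, L i) ≤ ∑ i ∈ t, Λ (L i) := by
    intro t
    induction t using Finset.induction_on with
    | empty => simp [h_empty]
    | insert n s hn ih =>
      rw [Finset.set_biUnion_insert, Finset.sum_insert hn]
      exact (h_union _ _).trans (by gcongr)
  calc Λ K ≤ ∑ i ∈ t, Λ (L i) := hKL ▸ h_sum t
    _ ≤ ∑ i ∈ t, innerExtension Λ (U i) :=
      Finset.sum_le_sum fun i _ => le_innerExtension Λ (hLc i) (hLU i)
    _ ≤ ∑' i, innerExtension Λ (U i) := ENNReal.sum_le_tsum t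

/-- A subadditive `[0,∞]`-valued set function that is superadditive on disjoint compact sets
induces an outer regular Borel measure. -/
theorem exists_measure_eq_innerExtension {X : Type*} [TopologicalSpace X] [T2Space X]
    [MeasurableSpace X] [BorelSpace X] {Λ : Set X → ℝ≥0∞} (h_empty : Λ ∅ = 0)
    (h_union : ∀ s t, Λ (s ∪ t) ≤ Λ s + Λ t)
    (h_disj : ∀ K L, IsCompact K → IsCompact L → Disjoint K L → Λ K + Λ L ≤ Λ (K ∪ L)) :
    ∃ μ : Measure X, (∀ U, IsOpen U → μ U = innerExtension Λ U) ∧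
      ∀ A, MeasurableSet A → μ A = ⨅ (U : Set X) (_ : IsOpen U ∧ A ⊆ U), μ U := by
  have m0 : innerExtension Λ ∅ = 0 := by
    refine le_antisymm (iSup₂_le fun K hK => ?_) zero_le
    rw [subset_empty_iff.1 hK.2, h_empty]
  have PU : ∀ ⦃f : ℕ → Set X⦄, (∀ i, IsOpen (f i)) → IsOpen (⋃ i, f i) :=
    fun _ => isOpen_iUnion
  have msU : ∀ ⦃f : ℕ → Set X⦄, (∀ i, IsOpen (f i)) →
      innerExtension Λ (⋃ i, f i) ≤ ∑' i, innerExtension Λ (f i) :=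
    fun _ hf => innerExtension_iUnion_le h_empty h_union hf
  have m_mono : ∀ ⦃s t : Set X⦄, IsOpen s → IsOpen t → s ⊆ t →
      innerExtension Λ s ≤ innerExtension Λ t :=
    fun _ _ _ _ h => innerExtension_mono Λ h
  set ν : OuterMeasure X :=
    inducedOuterMeasure (P := IsOpen) (fun U _ => innerExtension Λ U) isOpen_empty m0
  have ν_open : ∀ U, IsOpen U → ν U = innerExtension Λ U :=
    fun U hU => inducedOuterMeasure_eq' PU msU m_mono hU
  have h_meas : ‹MeasurableSpace X› ≤ ν.caratheodory := by
    rw [BorelSpace.measurable_eq (α := X)]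
    refine MeasurableSpace.generateFrom_le fun U (hU : IsOpen U) => ?_
    refine (inducedOuterMeasure_caratheodory PU msU m_mono U).2 fun V hV => ?_
    change ν (V ∩ U) + ν (V \ U) ≤ ν V
    rw [ν_open _ (hV.inter hU), ν_open V hV]
    conv_lhs => rw [innerExtension, iSup_subtype']
    have : Nonempty {L : Set X // IsCompact L ∧ L ⊆ V ∩ U} :=
      ⟨⟨∅, isCompact_empty, empty_subset _⟩⟩
    rw [ENNReal.iSup_add]
    refine iSup_le ?_
    rintro ⟨L, hL, hLVU⟩
    have h_le : ν (V \ U) ≤ innerExtension Λ (V \ L) :=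
      (measure_mono (sdiff_subset_sdiff_right (hLVU.trans inter_subset_right))).trans_eq
        (ν_open _ (hV.sdiff hL.isClosed))
    refine (add_le_add_right h_le _).trans ?_
    conv_lhs => rw [innerExtension, iSup_subtype']
    have : Nonempty {M : Set X // IsCompact M ∧ M ⊆ V \ L} :=
      ⟨⟨∅, isCompact_empty, empty_subset _⟩⟩
    rw [ENNReal.add_iSup]
    refine iSup_le ?_
    rintro ⟨M, hM, hMVL⟩
    have h_LM : Disjoint L M := disjoint_left.2 fun x hxL hxM => (hMVL hxM).2 hxL
    exact (h_disj L M hL hM h_LM).trans (le_innerExtension Λ (hL.union hM)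
      (union_subset (hLVU.trans inter_subset_left) (hMVL.trans sdiff_subset)))
  have h_open : ∀ U, IsOpen U → ν.toMeasure h_meas U = innerExtension Λ U := fun U hU => by
    rw [toMeasure_apply _ _ hU.measurableSet, ν_open U hU]
  refine ⟨ν.toMeasure h_meas, h_open, fun A hA => ?_⟩
  rw [toMeasure_apply _ _ hA]
  refine (inducedOuterMeasure_eq_iInf PU msU m_mono A).trans ?_
  simp only [iInf_and]
  exact iInf_congr fun U => iInf_congr fun hU => by rw [h_open U hU]

/-- A measurable set that is covered by open sets of finite measure is inner regular with respect
to compact sets. -/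
theorem measure_le_iSup_isCompact_of_locally_finite {X : Type*} [TopologicalSpace X] [T2Space X]
    [SecondCountableTopology X] [LocallyCompactSpace X] [MeasurableSpace X] [BorelSpace X]
    {μ : Measure X} {A : Set X} (hA : MeasurableSet A)
    (h_fin : ∀ x ∈ A, ∃ U, IsOpen U ∧ x ∈ U ∧ μ U ≠ ∞) :
    μ A ≤ ⨆ (K : Set X) (_ : IsCompact K ∧ K ⊆ A), μ K := by
  have h_of_ne_top : ∀ B ⊆ A, MeasurableSet B → μ B ≠ ∞ →
      μ B ≤ ⨆ (K : Set X) (_ : IsCompact K ∧ K ⊆ A), μ K := by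
    intro B hBA hB hμB
    have : IsFiniteMeasure (μ.restrict B) := isFiniteMeasure_restrict.2 hμB
    have h_eq := hB.measure_eq_iSup_isCompact_of_ne_top (μ := μ.restrict B) (measure_ne_top _ _)
    rw [Measure.restrict_apply_self] at h_eq
    rw [h_eq]
    refine iSup_le fun K => iSup_le fun hKB => iSup_le fun hK => ?_
    exact (Measure.restrict_apply_le _ _).trans (le_iSup₂_of_le K ⟨hK, hKB.trans hBA⟩ le_rfl)
  obtain ⟨T, hT, hTS, hTU⟩ := isOpen_sUnion_countable {U : Set X | IsOpen U ∧ μ U ≠ ∞}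
    fun U hU => hU.1
  have hAT : A ⊆ ⋃₀ T := fun x hx => by
    obtain ⟨U, hU, hxU, hμU⟩ := h_fin x hx
    rw [hTU]
    exact ⟨U, ⟨hU, hμU⟩, hxU⟩
  have : Countable T := hT
  have hA_eq : A = ⋃ s : Finset T, A ∩ ⋃ U ∈ s, (U : Set X) := by
    refine subset_antisymm (fun x hx => ?_) (iUnion_subset fun s => inter_subset_left)
    obtain ⟨U, hU, hxU⟩ := hAT hx
    exact mem_iUnion.2 ⟨{⟨U, hU⟩}, hx, by simpa using hxU⟩
  have h_mono : Monotone fun s : Finset T => A ∩ ⋃ U ∈ s, (U : Set X) :=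
    fun s t hst => inter_subset_inter_right _ (biUnion_subset_biUnion_left hst)
  conv_lhs => rw [hA_eq]
  rw [h_mono.directed_le.measure_iUnion]
  refine iSup_le fun s => h_of_ne_top _ inter_subset_left ?_ ?_
  · exact hA.inter (s.measurableSet_biUnion fun U _ => (hTS U.2).1.measurableSet)
  · refine ne_top_of_le_ne_top ?_ (measure_mono inter_subset_right)
    exact ((measure_biUnion_lt_top s.finite_toSet fun U _ => (hTS U.2).2.lt_top)).ne

theorem isRegularM_of_outerRegular {X : Type*} [TopologicalSpace X] [T2Space X]
    [SecondCountableTopology X] [LocallyCompactSpace X] [MeasurableSpace X] [BorelSpace X]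
    {μ : Measure X}
    (h_outer : ∀ A, MeasurableSet A → μ A = ⨅ (U : Set X) (_ : IsOpen U ∧ A ⊆ U), μ U) :
    IsRegularM μ := by
  refine ⟨h_outer, fun A hA => le_antisymm ?_ (iSup₂_le fun K hK => measure_mono hK.2)⟩
  by_cases h_fin : ∀ x ∈ A, ∃ U, IsOpen U ∧ x ∈ U ∧ μ U ≠ ∞
  · exact measure_le_iSup_isCompact_of_locally_finite hA h_fin
  · push Not at h_fin
    obtain ⟨x, hxA, hx⟩ := h_fin
    have h_top : μ {x} = ∞ := by
      rw [h_outer _ (measurableSet_singleton x)]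
      exact iInf₂_eq_top.2 fun U hU => hx U hU.1 (hU.2 rfl)
    refine le_top.trans (h_top ▸ ?_)
    exact le_iSup₂_of_le {x} ⟨isCompact_singleton, singleton_subset_iff.2 hxA⟩ le_rfl

/-- Along an ultrafilter, any family of measures has a regular limit in the sense of the
portmanteau inequalities on open and on compact sets. -/
theorem exists_isRegularM_ultrafilter_limit {X ι : Type*} [TopologicalSpace X] [T2Space X]
    [SecondCountableTopology X] [LocallyCompactSpace X] [MeasurableSpace X] [BorelSpace X]
    (ω : Ultrafilter ι) (u : ι → Measure X) :
    ∃ μ : Measure X, IsRegularM μ ∧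
      (∀ U c, IsOpen U → Tendsto (fun i => u i U) ω (𝓝 c) → μ U ≤ c) ∧
      ∀ K c, IsCompact K → Tendsto (fun i => u i K) ω (𝓝 c) → c ≤ μ K := by
  have h_lim : ∀ s : Set X, ∃ c, Tendsto (fun i => u i s) ω (𝓝 c) := fun s =>
    ⟨_, (ω.map fun i => u i s).le_nhds_lim⟩
  choose Λ hΛ using h_lim
  have h_empty : Λ ∅ = 0 :=
    tendsto_nhds_unique (hΛ ∅) (by simp)
  have h_mono : ∀ s t, s ⊆ t → Λ s ≤ Λ t := fun s t hst =>
    le_of_tendsto_of_tendsto' (hΛ s) (hΛ t) fun i => measure_mono hst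
  have h_union : ∀ s t, Λ (s ∪ t) ≤ Λ s + Λ t := fun s t =>
    le_of_tendsto_of_tendsto' (hΛ _) ((hΛ s).add (hΛ t)) fun i => measure_union_le s t
  have h_disj : ∀ K L, IsCompact K → IsCompact L → Disjoint K L → Λ K + Λ L ≤ Λ (K ∪ L) :=
    fun K L _ hL hKL => le_of_tendsto_of_tendsto' ((hΛ K).add (hΛ L)) (hΛ _) fun i =>
      (measure_union hKL hL.measurableSet).ge
  obtain ⟨μ, h_open, h_outer⟩ := exists_measure_eq_innerExtension h_empty h_union h_disj
  refine ⟨μ, isRegularM_of_outerRegular h_outer, fun U c hU hc => ?_, fun K c hK hc => ?_⟩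
  · rw [tendsto_nhds_unique hc (hΛ U), h_open U hU]
    exact iSup₂_le fun K hK => h_mono K U hK.2
  · rw [tendsto_nhds_unique hc (hΛ K), h_outer K hK.measurableSet]
    refine le_iInf₂ fun U hU => ?_
    rw [h_open U hU.1]
    exact le_innerExtension Λ hK hU.2

theorem isOpen_IooI (I : Set ℝ) (a b : ℝ) : IsOpen (IooI I a b) :=
  isOpen_Ioo.preimage continuous_subtype_val

theorem isCompact_IccI {I : Set ℝ} (hI : I.OrdConnected) {a b : ℝ} (ha : a ∈ I) (hb : b ∈ I) :
    IsCompact (IccI I a b) :=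
  Topology.IsInducing.subtypeVal.isCompact_preimage' isCompact_Icc
    (by simpa using hI.out ha hb)

/-- `(M(I), ϑ)` is sequentially compact: every sequence has a convergent subsequence. -/
theorem stmt_8 (I : Set ℝ) (hIopen : IsOpen I) (hIconn : I.OrdConnected) :
    ∀ u : ℕ → MSpace I, ∃ (m : MSpace I) (φ : ℕ → ℕ), StrictMono φ ∧
      Filter.Tendsto (u ∘ φ) Filter.atTop (𝓝 m) := by
  intro u
  obtain ⟨L, φ, hφ, hL⟩ := CompactSpace.tendsto_subseq fun n => fun p : ℚ × ℚ =>
    ((u n).1 (IooI I p.1 p.2), (u n).1 (IccI I p.1 p.2))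
  rw [tendsto_pi_nhds] at hL
  have : LocallyCompactSpace I := hIopen.locallyCompactSpace
  obtain ⟨μ, hμ, h_open, h_compact⟩ := exists_isRegularM_ultrafilter_limit
    (Ultrafilter.of (atTop : Filter ℕ)) fun n => (u (φ n)).1
  have hω : (Ultrafilter.of (atTop : Filter ℕ) : Filter ℕ) ≤ atTop := Ultrafilter.of_le _
  refine ⟨⟨μ, hμ⟩, φ, hφ, tendsto_subtype_rng.2 (tendsto_nhds_generateFrom_iff.2 ?_)⟩
  rintro s (⟨a, b, c, ha, hb, -, rfl⟩ | ⟨a, b, d, ha, hb, -, rfl⟩) hs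
  · have h_tendsto := (hL (a, b)).fst_nhds
    exact h_tendsto.eventually_const_lt
      (lt_of_lt_of_le hs (h_open _ _ (isOpen_IooI I a b) (h_tendsto.mono_left hω)))
  · have h_tendsto := (hL (a, b)).snd_nhds
    exact h_tendsto.eventually_lt_const
      (lt_of_le_of_lt (h_compact _ _ (isCompact_IccI hIconn ha hb) (h_tendsto.mono_left hω)) hs)
end
end

section
/- Define H: M(ℝ) × [0,1] → M(ℝ) by H(m, 0) = m and, for ε ∈ (0,1], H(m, ε) = (1−ε)·h(m,ε,·)·λ where h(m,ε,x) = min(∫_ℝ ρ_ε(x−y) dm(y), 1/ε²) and ρ_ε is the triangular kernel of height 1/ε and support [−ε,ε]. Then H is continuous (with M(ℝ) carrying the topology ϑ), H(m,0) = m, H(m,1) = 0, and H(m,ε) is a locally finite (absolutely continuous, with bounded density) measure for every ε > 0. In particular, M(ℝ) is contractible and M_loc(ℝ) is homotopy dense in M(ℝ). -/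
open MeasureTheory Set ENNReal Topology Filter TopologicalSpace

noncomputable section

/-- The explosion set `e(m)` of a measure on `ℝ`. -/
def explosionSetR (m : Measure ℝ) : Set ℝ :=
  {x | ∀ ε : ℝ, 0 < ε → m (Set.Ioo (x - ε) (x + ε)) = ∞}

/-- The topology `ϑ` on measures over `ℝ`, generated by the subbasic sets
`{m | m((a,b)) > c}` and `{m | m([a,b]) < d}` for rational endpoints. -/
instance thetaTopR : TopologicalSpace (Measure ℝ) :=
  TopologicalSpace.generateFrom
    ({U | ∃ (a b : ℚ) (c : ℝ≥0∞), (a : ℝ) < b ∧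
        U = {m : Measure ℝ | c < m (Set.Ioo (a : ℝ) (b : ℝ))}} ∪
     {U | ∃ (a b : ℚ) (d : ℝ≥0∞), (a : ℝ) ≤ b ∧
        U = {m : Measure ℝ | m (Set.Icc (a : ℝ) (b : ℝ)) < d}})

/-- The space `M(ℝ)` of regular nonnegative `[0,∞]`-valued measures on `ℝ`,
with the subspace topology inherited from `ϑ`. -/
abbrev MR : Type := {m : Measure ℝ // IsRegularM m}

/-- The triangular mollifier kernel `ρ_ε` of height `1/ε` and support `[−ε, ε]`. -/
def rho (ε x : ℝ) : ℝ := (1 / ε) * max (1 - |x| / ε) 0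

/-- The measure `H(m,ε) = (1−ε)·h(m,ε,·)·λ`, where
`h(m,ε,x) = min(∫ ρ_ε(x−y) dm(y), 1/ε²)`. -/
def Hmeas (m : Measure ℝ) (ε : ℝ) : Measure ℝ :=
  (ENNReal.ofReal (1 - ε)) •
    volume.withDensity (fun x =>
      min (∫⁻ y, ENNReal.ofReal (rho ε (x - y)) ∂m) (ENNReal.ofReal (1 / ε ^ 2)))

/-- The convolution `ρ_ε * m`, evaluated at `x`. -/
def mollify (m : Measure ℝ) (ε x : ℝ) : ℝ≥0∞ := ∫⁻ y, ENNReal.ofReal (rho ε (x - y)) ∂m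

/-- The truncated density `h(m, ε, x) = min ((ρ_ε * m) x) (1/ε²)`. -/
def truncDensity (m : Measure ℝ) (ε x : ℝ) : ℝ≥0∞ :=
  min (mollify m ε x) (ENNReal.ofReal (1 / ε ^ 2))

lemma Hmeas_apply (m : Measure ℝ) (ε : ℝ) {A : Set ℝ} (hA : MeasurableSet A) :
    Hmeas m ε A = ENNReal.ofReal (1 - ε) * ∫⁻ x in A, truncDensity m ε x := by
  rw [Hmeas, Measure.smul_apply, withDensity_apply _ hA, smul_eq_mul]
  rfl

section Kernel

lemma continuous_rho (ε : ℝ) : Continuous (rho ε) := by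
  unfold rho
  fun_prop

lemma rho_nonneg {ε : ℝ} (hε : 0 < ε) (x : ℝ) : 0 ≤ rho ε x := by
  unfold rho
  positivity

lemma rho_le {ε : ℝ} (hε : 0 < ε) (x : ℝ) : rho ε x ≤ 1 / ε := by
  unfold rho
  have h : max (1 - |x| / ε) 0 ≤ 1 := max_le (sub_le_self _ (by positivity)) zero_le_one
  exact mul_le_of_le_one_right (by positivity) h

lemma rho_eq_zero {ε : ℝ} (hε : 0 < ε) {x : ℝ} (hx : ε ≤ |x|) : rho ε x = 0 := by
  unfold rho
  have : 1 ≤ |x| / ε := (one_le_div hε).2 hx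
  rw [max_eq_right (by linarith), mul_zero]

lemma lt_rho_iff {ε t : ℝ} (hε : 0 < ε) (ht : 0 < t) (x : ℝ) :
    t < rho ε x ↔ |x| < ε - ε ^ 2 * t := by
  have h0 : rho ε x = max ((ε - |x|) / ε ^ 2) 0 := by
    unfold rho
    rw [mul_max_of_nonneg _ _ (by positivity)]
    congr 1
    · field_simp
    · simp
  rw [h0, lt_max_iff, lt_div_iff₀ (by positivity)]
  constructor
  · rintro (h | h) <;> linarith
  · intro h
    left
    linarith

lemma setOf_lt_rho {ε t : ℝ} (hε : 0 < ε) (ht : 0 < t) (x : ℝ) :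
    {y | t < rho ε (x - y)} = Ioo (x - (ε - ε ^ 2 * t)) (x + (ε - ε ^ 2 * t)) := by
  ext y
  rw [mem_ofPred_eq, lt_rho_iff hε ht, abs_lt, mem_Ioo]
  constructor <;> rintro ⟨h₁, h₂⟩ <;> constructor <;> linarith

/-- Layer-cake formula for the convolution with the triangular kernel. -/
lemma mollify_eq_lintegral_Ioo (m : Measure ℝ) {ε : ℝ} (hε : 0 < ε) (x : ℝ) :
    mollify m ε x =
      ∫⁻ t in Ioi (0 : ℝ), m (Ioo (x - (ε - ε ^ 2 * t)) (x + (ε - ε ^ 2 * t))) := by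
  rw [mollify, lintegral_eq_lintegral_meas_lt m
    (Eventually.of_forall fun y => rho_nonneg hε (x - y))
    ((continuous_rho ε).comp (by fun_prop)).measurable.aemeasurable]
  refine setLIntegral_congr_fun measurableSet_Ioi fun t ht => ?_
  simp only [setOf_lt_rho hε ht]

lemma lintegral_rho {ε : ℝ} (hε : 0 < ε) : ∫⁻ x, ENNReal.ofReal (rho ε x) = 1 := by
  have h := mollify_eq_lintegral_Ioo volume hε 0
  have hsymm : mollify volume ε 0 = ∫⁻ x, ENNReal.ofReal (rho ε x) := by
    simp only [mollify, rho, zero_sub, abs_neg]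
  rw [← hsymm, h]
  have hind : ∀ t ∈ Ioi (0 : ℝ),
      volume (Ioo (0 - (ε - ε ^ 2 * t)) (0 + (ε - ε ^ 2 * t))) =
        (Ioc 0 (1 / ε)).indicator (fun t => ENNReal.ofReal (2 * (ε - ε ^ 2 * t))) t := by
    intro t ht
    rw [Real.volume_Ioo]
    by_cases hmem : t ∈ Ioc 0 (1 / ε)
    · rw [indicator_of_mem hmem]
      congr 1
      ring
    · rw [indicator_of_notMem hmem]
      have ht' : 1 / ε < t := by
        by_contra hle
        exact hmem ⟨ht, not_lt.1 hle⟩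
      have : 1 < t * ε := (div_lt_iff₀ hε).1 ht'
      exact ENNReal.ofReal_of_nonpos (by nlinarith)
  have hcont : Continuous fun t : ℝ => 2 * (ε - ε ^ 2 * t) := by fun_prop
  rw [setLIntegral_congr_fun measurableSet_Ioi hind, setLIntegral_indicator measurableSet_Ioc,
    inter_eq_left.2 Ioc_subset_Ioi_self,
    ← ofReal_integral_eq_lintegral_ofReal
      ((hcont.integrableOn_Icc).mono_set Ioc_subset_Icc_self) ?_,
    ← intervalIntegral.integral_of_le (by positivity)]
  · have hint : ∫ t in (0 : ℝ)..(1 / ε), 2 * (ε - ε ^ 2 * t) = 1 := by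
      rw [intervalIntegral.integral_const_mul, intervalIntegral.integral_sub
        intervalIntegrable_const
        ((by fun_prop : Continuous fun t : ℝ => ε ^ 2 * t).intervalIntegrable _ _),
        intervalIntegral.integral_const_mul]
      simp
      field_simp
      norm_num
    rw [hint, ENNReal.ofReal_one]
  · filter_upwards [ae_restrict_mem measurableSet_Ioc] with t ht
    have : t * ε ≤ 1 := (le_div_iff₀ hε).1 ht.2
    show 0 ≤ 2 * (ε - ε ^ 2 * t)
    nlinarith

lemma lintegral_rho_sub {ε : ℝ} (hε : 0 < ε) (y : ℝ) :
    ∫⁻ x, ENNReal.ofReal (rho ε (x - y)) = 1 := by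
  rw [lintegral_sub_right_eq_self (fun x => ENNReal.ofReal (rho ε x)) y, lintegral_rho hε]

end Kernel

section Density

lemma lowerSemicontinuous_mollify (m : Measure ℝ) (ε : ℝ) :
    LowerSemicontinuous (mollify m ε) := by
  rw [lowerSemicontinuous_iff_le_liminf]
  intro x
  have hcont : ∀ y, Continuous fun z => ENNReal.ofReal (rho ε (z - y)) := fun y =>
    ENNReal.continuous_ofReal.comp ((continuous_rho ε).comp (by fun_prop))
  calc mollify m ε x
      = ∫⁻ y, liminf (fun z => ENNReal.ofReal (rho ε (z - y))) (𝓝 x) ∂m :=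
        lintegral_congr fun y => ((hcont y).tendsto x).liminf_eq.symm
    _ ≤ liminf (mollify m ε) (𝓝 x) := lintegral_liminf_le fun z =>
        (ENNReal.continuous_ofReal.comp ((continuous_rho ε).comp (by fun_prop))).measurable

lemma measurable_truncDensity (m : Measure ℝ) (ε : ℝ) : Measurable (truncDensity m ε) :=
  (lowerSemicontinuous_mollify m ε).measurable.min measurable_const

lemma truncDensity_le (m : Measure ℝ) (ε x : ℝ) :
    truncDensity m ε x ≤ ENNReal.ofReal (1 / ε ^ 2) := min_le_right _ _

lemma Hmeas_le (m : Measure ℝ) (ε : ℝ) {A : Set ℝ} (hA : MeasurableSet A) :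
    Hmeas m ε A ≤ ENNReal.ofReal (1 - ε) * ENNReal.ofReal (1 / ε ^ 2) * volume A := by
  rw [Hmeas_apply m ε hA, mul_assoc]
  gcongr
  calc ∫⁻ x in A, truncDensity m ε x
      ≤ ∫⁻ _ in A, ENNReal.ofReal (1 / ε ^ 2) := lintegral_mono fun x => truncDensity_le m ε x
    _ = _ := setLIntegral_const _ _

lemma Hmeas_absolutelyContinuous (m : Measure ℝ) (ε : ℝ) : Hmeas m ε ≪ volume :=
  (withDensity_absolutelyContinuous _ _).smul_left _

lemma Hmeas_Ioo_lt_top (m : Measure ℝ) (ε a b : ℝ) : Hmeas m ε (Ioo a b) < ∞ :=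
  (Hmeas_le m ε measurableSet_Ioo).trans_lt <| ENNReal.mul_lt_top
    (ENNReal.mul_lt_top ENNReal.ofReal_lt_top ENNReal.ofReal_lt_top) measure_Ioo_lt_top

lemma isRegularM_of_isLocallyFiniteMeasure (m : Measure ℝ) [IsLocallyFiniteMeasure m] :
    IsRegularM m := by
  refine ⟨fun A _ => ?_, fun A hA => ?_⟩
  · rw [A.measure_eq_iInf_isOpen]
    simp only [iInf_and]
    exact iInf_congr fun U => iInf_comm
  · rw [hA.measure_eq_iSup_isCompact]
    simp only [iSup_and]
    exact iSup_congr fun K => iSup_comm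

lemma isRegularM_Hmeas (m : Measure ℝ) (ε : ℝ) : IsRegularM (Hmeas m ε) := by
  have : IsLocallyFiniteMeasure (Hmeas m ε) := ⟨fun x =>
    ⟨Ioo (x - 1) (x + 1), Ioo_mem_nhds (by linarith) (by linarith), Hmeas_Ioo_lt_top m ε _ _⟩⟩
  exact isRegularM_of_isLocallyFiniteMeasure _

lemma explosionSetR_Hmeas (m : Measure ℝ) (ε : ℝ) : explosionSetR (Hmeas m ε) = ∅ :=
  eq_empty_of_forall_notMem fun x hx =>
    (Hmeas_Ioo_lt_top m ε (x - 1) (x + 1)).ne (hx 1 one_pos)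

lemma Hmeas_one (m : Measure ℝ) : Hmeas m 1 = 0 := by
  simp [Hmeas]

end Density

section Explosion

/-- A compact interval of infinite mass contains an explosion point. -/
lemma exists_mem_explosionSetR {m : Measure ℝ} {a b : ℝ} (h : m (Icc a b) = ∞) :
    ∃ p ∈ Icc a b, p ∈ explosionSetR m := by
  by_contra! hne
  refine (isCompact_Icc.measure_lt_top_of_nhdsWithin (μ := m) fun x hx => ?_).ne h
  have hx' := hne x hx
  simp only [explosionSetR, mem_ofPred_eq, not_forall] at hx'
  obtain ⟨δ, hδ, hfin⟩ := hx'
  exact ⟨Ioo (x - δ) (x + δ), mem_nhdsWithin_of_mem_nhds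
    (Ioo_mem_nhds (by linarith) (by linarith)), lt_top_iff_ne_top.2 hfin⟩

/-- The convolution dominates the mass near a point `p` in the interior of the support of the
kernel, locally uniformly in the bandwidth. -/
lemma exists_mul_measure_le_mollify {ε x p : ℝ} (hε : 0 < ε) (hp : |x - p| < ε) :
    ∃ k δ : ℝ, 0 < k ∧ 0 < δ ∧ ∀ᶠ ε' in 𝓝 ε, ∀ m : Measure ℝ,
      ENNReal.ofReal k * m (Ioo (p - δ) (p + δ)) ≤ mollify m ε' x := by
  set r := |x - p| with hr
  have hr0 : 0 ≤ r := abs_nonneg _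
  have hεr : 0 < ε - r := sub_pos.2 hp
  refine ⟨((ε - r) / 4) / (2 * ε) ^ 2, (ε - r) / 4, by positivity, by linarith, ?_⟩
  filter_upwards [Ioo_mem_nhds (show (ε + r) / 2 < ε by linarith) (show ε < 2 * ε by linarith)]
    with ε' hε' m
  have hε0 : 0 < ε' := by linarith [hε'.1]
  rw [← setLIntegral_const]
  refine le_trans (setLIntegral_mono' measurableSet_Ioo fun y hy => ?_)
    (setLIntegral_le_lintegral _ _)
  refine ENNReal.ofReal_le_ofReal ?_
  have hy' : |x - y| ≤ r + (ε - r) / 4 := by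
    have h1 : |p - y| ≤ (ε - r) / 4 := abs_le.2 ⟨by linarith [hy.2], by linarith [hy.1]⟩
    calc |x - y| = |(x - p) + (p - y)| := by ring_nf
      _ ≤ _ := (abs_add_le _ _).trans (by linarith)
  have hrho : (ε' - |x - y|) / ε' ^ 2 ≤ rho ε' (x - y) := by
    unfold rho
    calc (ε' - |x - y|) / ε' ^ 2 = 1 / ε' * (1 - |x - y| / ε') := by field_simp
      _ ≤ _ := by gcongr; exact le_max_left _ _
  refine le_trans ?_ hrho
  have h2 := hε'.1
  have h3 := hε'.2
  gcongr
  · linarith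
  · linarith

lemma mollify_eq_top {m : Measure ℝ} {ε x p : ℝ} (hε : 0 < ε) (hp : |x - p| < ε)
    (hpm : p ∈ explosionSetR m) : mollify m ε x = ∞ := by
  obtain ⟨k, δ, hk, hδ, h⟩ := exists_mul_measure_le_mollify hε hp
  have h' := h.self_of_nhds m
  rwa [hpm δ hδ, ENNReal.mul_top (ENNReal.ofReal_pos.2 hk).ne', top_le_iff] at h'

/-- Points at distance exactly `ε` from the closest explosion point form a countable set. -/
lemma countable_infDist_explosionSetR_eq (m : Measure ℝ) {ε : ℝ} (hε : 0 < ε) :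
    {x | m (Icc (x - ε) (x + ε)) = ∞ ∧ ∀ p ∈ explosionSetR m, ε ≤ |x - p|}.Countable := by
  set e := explosionSetR m
  have hsep : ∀ x y, x < y → (∀ p ∈ e, ε ≤ |y - p|) → x + ε ∈ e → x + 2 * ε ≤ y := by
    intro x y hxy hy hx
    rcases le_abs.1 (hy _ hx) with h | h <;> linarith
  have hsep' : ∀ x y, x < y → (∀ p ∈ e, ε ≤ |x - p|) → y - ε ∈ e → x + 2 * ε ≤ y := by
    intro x y hxy hx hy
    rcases le_abs.1 (hx _ hy) with h | h <;> linarith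
  have hdisj : ∀ s : Set ℝ, (∀ x ∈ s, ∀ y ∈ s, x < y → x + 2 * ε ≤ y) → s.Countable := by
    intro s hs
    refine PairwiseDisjoint.countable_of_Ioo (y := fun x => x + 2 * ε) ?_ fun x _ => by linarith
    intro x hx y hy hxy
    refine disjoint_left.2 fun z hz hz' => ?_
    rcases lt_or_gt_of_ne hxy with h | h
    · linarith [hs x hx y hy h, hz.2, hz'.1]
    · linarith [hs y hy x hx h, hz'.2, hz.1]
  refine ((hdisj {x | (∀ p ∈ e, ε ≤ |x - p|) ∧ x + ε ∈ e} fun x hx y hy hxy =>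
    hsep x y hxy hy.1 hx.2).union (hdisj {x | (∀ p ∈ e, ε ≤ |x - p|) ∧ x - ε ∈ e}
      fun x hx y hy hxy => hsep' x y hxy hx.1 hy.2)).mono ?_
  rintro x ⟨htop, hx⟩
  obtain ⟨p, hp, hpe⟩ := exists_mem_explosionSetR htop
  rcases le_abs.1 (hx p hpe) with h | h
  · right
    have : p = x - ε := by linarith [hp.1]
    exact ⟨hx, this ▸ hpe⟩
  · left
    have : p = x + ε := by linarith [hp.2]
    exact ⟨hx, this ▸ hpe⟩

end Explosion

section Topology

lemma isOpen_lt_measure_Ioo {a b : ℚ} (hab : (a : ℝ) < b) (c : ℝ≥0∞) :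
    IsOpen {m : Measure ℝ | c < m (Ioo (a : ℝ) b)} :=
  isOpen_generateFrom_of_mem (Or.inl ⟨a, b, c, hab, rfl⟩)

lemma isOpen_measure_Icc_lt {a b : ℚ} (hab : (a : ℝ) ≤ b) (d : ℝ≥0∞) :
    IsOpen {m : Measure ℝ | m (Icc (a : ℝ) b) < d} :=
  isOpen_generateFrom_of_mem (Or.inr ⟨a, b, d, hab, rfl⟩)

instance secondCountableTopology_thetaTopR : SecondCountableTopology (Measure ℝ) := by
  obtain ⟨D, hDc, hD⟩ := exists_countable_dense ℝ≥0∞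
  have : Countable D := hDc.to_subtype
  let S₁ : Set (Set (Measure ℝ)) := range fun q : ({q : ℚ × ℚ // (q.1 : ℝ) < q.2} × D) =>
    {m : Measure ℝ | (q.2 : ℝ≥0∞) < m (Ioo (q.1.1.1 : ℝ) q.1.1.2)}
  let S₂ : Set (Set (Measure ℝ)) := range fun q : ({q : ℚ × ℚ // (q.1 : ℝ) ≤ q.2} × D) =>
    {m : Measure ℝ | m (Icc (q.1.1.1 : ℝ) q.1.1.2) < (q.2 : ℝ≥0∞)}
  refine ⟨S₁ ∪ S₂, (countable_range _).union (countable_range _), le_antisymm ?_ ?_⟩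
  · refine le_generateFrom ?_
    rintro U (⟨⟨⟨q, hq⟩, c⟩, rfl⟩ | ⟨⟨⟨q, hq⟩, d⟩, rfl⟩)
    · exact isOpen_lt_measure_Ioo hq _
    · exact isOpen_measure_Icc_lt hq _
  · refine le_generateFrom ?_
    rintro U (⟨a, b, c, hab, rfl⟩ | ⟨a, b, d, hab, rfl⟩)
    · have : {m : Measure ℝ | c < m (Ioo (a : ℝ) b)} =
          ⋃ (q : D) (_ : c < q), {m : Measure ℝ | (q : ℝ≥0∞) < m (Ioo (a : ℝ) b)} := by
        ext m
        simp only [mem_ofPred_eq, mem_iUnion, exists_prop]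
        constructor
        · intro h
          obtain ⟨q, hq, h₁, h₂⟩ := hD.exists_between h
          exact ⟨⟨q, hq⟩, h₁, h₂⟩
        · rintro ⟨q, h₁, h₂⟩
          exact h₁.trans h₂
      rw [this]
      let _ := generateFrom (S₁ ∪ S₂)
      exact isOpen_iUnion fun q => isOpen_iUnion fun _ =>
        isOpen_generateFrom_of_mem (Or.inl ⟨⟨⟨(a, b), hab⟩, q⟩, rfl⟩)
    · have : {m : Measure ℝ | m (Icc (a : ℝ) b) < d} =
          ⋃ (q : D) (_ : q < d), {m : Measure ℝ | m (Icc (a : ℝ) b) < (q : ℝ≥0∞)} := by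
        ext m
        simp only [mem_ofPred_eq, mem_iUnion, exists_prop]
        constructor
        · intro h
          obtain ⟨q, hq, h₁, h₂⟩ := hD.exists_between h
          exact ⟨⟨q, hq⟩, h₂, h₁⟩
        · rintro ⟨q, h₁, h₂⟩
          exact h₂.trans h₁
      rw [this]
      let _ := generateFrom (S₁ ∪ S₂)
      exact isOpen_iUnion fun q => isOpen_iUnion fun _ =>
        isOpen_generateFrom_of_mem (Or.inr ⟨⟨⟨(a, b), hab⟩, q⟩, rfl⟩)

instance secondCountableTopology_MR : SecondCountableTopology MR :=
  secondCountableTopology_induced MR (Measure ℝ) Subtype.val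

/-- Lower semicontinuity of the mass of an open interval, with some room at the endpoints. -/
lemma exists_eventually_lt_measure_Ioo (m₀ : MR) {a b : ℝ} {c : ℝ≥0∞} (h : c < m₀.1 (Ioo a b)) :
    ∃ a' b' : ℝ, a < a' ∧ a' < b' ∧ b' < b ∧ ∀ᶠ m : MR in 𝓝 m₀, c < m.1 (Ioo a' b') := by
  rw [m₀.2.2 _ measurableSet_Ioo] at h
  simp only [lt_iSup_iff] at h
  obtain ⟨K, ⟨hK, hKab⟩, hcK⟩ := h
  have hne : K.Nonempty := by
    by_contra hne
    simp [not_nonempty_iff_eq_empty.1 hne] at hcK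
  have hinf := hK.sInf_mem hne
  have hsup := hK.sSup_mem hne
  obtain ⟨a', ha, ha'⟩ := exists_rat_btwn (hKab hinf).1
  obtain ⟨b', hb', hb⟩ := exists_rat_btwn (hKab hsup).2
  have hle : sInf K ≤ sSup K := csInf_le hK.bddBelow hsup
  have hab' : (a' : ℝ) < b' := by linarith
  refine ⟨a', b', ha, hab', hb, ?_⟩
  refine continuous_subtype_val.continuousAt.preimage_mem_nhds
    ((isOpen_lt_measure_Ioo hab' c).mem_nhds (hcK.trans_le (measure_mono fun x hx => ?_)))
  exact ⟨ha'.trans_le (csInf_le hK.bddBelow hx), (le_csSup hK.bddAbove hx).trans_lt hb'⟩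

/-- Upper semicontinuity of the mass of a compact interval, with some room at the endpoints. -/
lemma exists_eventually_measure_Icc_lt (m₀ : MR) {a b : ℝ} (hab : a ≤ b) {d : ℝ≥0∞}
    (h : m₀.1 (Icc a b) < d) :
    ∃ a' b' : ℝ, a' < a ∧ b < b' ∧ m₀.1 (Icc a' b') < d ∧
      ∀ᶠ m : MR in 𝓝 m₀, m.1 (Icc a' b') < d := by
  rw [m₀.2.1 _ measurableSet_Icc] at h
  simp only [iInf_lt_iff] at h
  obtain ⟨U, ⟨hU, habU⟩, hUd⟩ := h
  obtain ⟨l, hl, hlU⟩ := exists_Ioc_subset_of_mem_nhds (hU.mem_nhds (habU ⟨le_rfl, hab⟩))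
    (exists_lt a)
  obtain ⟨u, hu, huU⟩ := exists_Ico_subset_of_mem_nhds (hU.mem_nhds (habU ⟨hab, le_rfl⟩))
    (exists_gt b)
  obtain ⟨a', ha', ha⟩ := exists_rat_btwn hl
  obtain ⟨b', hb, hb'⟩ := exists_rat_btwn hu
  have hlt : m₀.1 (Icc (a' : ℝ) b') < d := by
    refine (measure_mono fun x hx => ?_).trans_lt hUd
    rcases le_total x a with hxa | hxa
    · exact hlU ⟨ha'.trans_le hx.1, hxa⟩
    rcases le_total b x with hxb | hxb
    · exact huU ⟨hxb, hx.2.trans_lt hb'⟩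
    · exact habU ⟨hxa, hxb⟩
  exact ⟨a', b', ha, hb, hlt, continuous_subtype_val.continuousAt.preimage_mem_nhds
    ((isOpen_measure_Icc_lt (by linarith) d).mem_nhds hlt)⟩

lemma tendsto_measure_Ioo {ι : Type*} {l : Filter ι} {μ : ι → MR} {m₀ : MR} {R : ι → ℝ}
    {x R₀ : ℝ} (hμ : Tendsto μ l (𝓝 m₀)) (hR : Tendsto R l (𝓝 R₀))
    (h₀ : m₀.1 {y | |x - y| = R₀} = 0) :
    Tendsto (fun i => (μ i).1 (Ioo (x - R i) (x + R i))) l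
      (𝓝 (m₀.1 (Ioo (x - R₀) (x + R₀)))) := by
  refine tendsto_order.2 ⟨fun c hc => ?_, fun d hd => ?_⟩
  · obtain ⟨a', b', ha, -, hb, hev⟩ := exists_eventually_lt_measure_Ioo m₀ hc
    filter_upwards [hμ.eventually hev, (hR.const_sub x).eventually_lt_const ha,
      (hR.const_add x).eventually_const_lt hb] with i h₁ h₂ h₃
    exact h₁.trans_le (measure_mono (Ioo_subset_Ioo h₂.le h₃.le))
  · rcases lt_or_ge R₀ 0 with hneg | hnn
    · filter_upwards [hR.eventually_lt_const hneg] with i hi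
      rw [Ioo_eq_empty (by linarith), measure_empty]
      exact (zero_le).trans_lt hd
    · have hIcc : m₀.1 (Icc (x - R₀) (x + R₀)) < d := by
        refine lt_of_le_of_lt ?_ hd
        calc m₀.1 (Icc (x - R₀) (x + R₀))
            ≤ m₀.1 (Ioo (x - R₀) (x + R₀) ∪ {y | |x - y| = R₀}) := by
              refine measure_mono fun y hy => ?_
              have hle : |x - y| ≤ R₀ := abs_le.2 ⟨by linarith [hy.2], by linarith [hy.1]⟩
              rcases hle.lt_or_eq with h | h
              · left
                rw [abs_lt] at h
                exact ⟨by linarith, by linarith⟩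
              · exact Or.inr h
          _ ≤ _ := (measure_union_le _ _).trans (by rw [h₀, add_zero])
      obtain ⟨a', b', ha, hb, -, hev⟩ :=
        exists_eventually_measure_Icc_lt m₀ (by linarith) hIcc
      filter_upwards [hμ.eventually hev, (hR.const_sub x).eventually_const_lt ha,
        (hR.const_add x).eventually_lt_const hb] with i h₁ h₂ h₃
      exact (measure_mono (Ioo_subset_Icc_self.trans (Icc_subset_Icc h₂.le h₃.le))).trans_lt h₁

end Topology

section PositiveBandwidth

variable {m₀ : MR} {ε₀ x : ℝ}

lemma tendsto_mollify_of_explosion (hε₀ : 0 < ε₀) {p : ℝ} (hp : p ∈ explosionSetR m₀.1)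
    (hxp : |x - p| < ε₀) :
    Tendsto (fun q : MR × ℝ => mollify q.1.1 q.2 x) (𝓝 (m₀, ε₀)) (𝓝 (mollify m₀.1 ε₀ x)) := by
  rw [mollify_eq_top hε₀ hxp hp]
  obtain ⟨k, δ, hk, hδ, h⟩ := exists_mul_measure_le_mollify hε₀ hxp
  have hk0 : ENNReal.ofReal k ≠ 0 := (ENNReal.ofReal_pos.2 hk).ne'
  refine ENNReal.tendsto_nhds_top_iff_nnreal.2 fun N => ?_
  have hlt : (N : ℝ≥0∞) / ENNReal.ofReal k < m₀.1 (Ioo (p - δ) (p + δ)) := by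
    rw [hp δ hδ]
    exact ENNReal.div_lt_top ENNReal.coe_ne_top hk0
  obtain ⟨a', b', ha, -, hb, hev⟩ := exists_eventually_lt_measure_Ioo m₀ hlt
  filter_upwards [(continuous_fst.tendsto (m₀, ε₀)).eventually hev,
    (continuous_snd.tendsto (m₀, ε₀)).eventually h] with q h₁ h₂
  refine lt_of_lt_of_le ?_ (h₂ q.1.1)
  rw [mul_comm]
  refine (ENNReal.div_lt_iff (Or.inl hk0) (Or.inl ENNReal.ofReal_ne_top)).1 ?_
  exact h₁.trans_le (measure_mono (Ioo_subset_Ioo ha.le hb.le))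

lemma tendsto_mollify_of_finite (hε₀ : 0 < ε₀) (hfin : m₀.1 (Icc (x - ε₀) (x + ε₀)) < ∞) :
    Tendsto (fun q : MR × ℝ => mollify q.1.1 q.2 x) (𝓝 (m₀, ε₀)) (𝓝 (mollify m₀.1 ε₀ x)) := by
  obtain ⟨D, hD, hDtop⟩ := exists_between hfin
  obtain ⟨a', b', ha, hb, -, hev⟩ := exists_eventually_measure_Icc_lt m₀ (by linarith) hD
  have hsnd : Tendsto (fun q : MR × ℝ => q.2) (𝓝 (m₀, ε₀)) (𝓝 ε₀) :=
    continuous_snd.tendsto (m₀, ε₀)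
  have hpos : ∀ᶠ q : MR × ℝ in 𝓝 (m₀, ε₀), ε₀ / 2 < q.2 :=
    hsnd.eventually_const_lt (by linarith)
  rw [mollify_eq_lintegral_Ioo m₀.1 hε₀ x]
  refine Tendsto.congr' (f₁ := fun q : MR × ℝ => ∫⁻ t in Ioi (0 : ℝ),
    q.1.1 (Ioo (x - (q.2 - q.2 ^ 2 * t)) (x + (q.2 - q.2 ^ 2 * t)))) ?_ ?_
  · filter_upwards [hpos] with q hq
    exact (mollify_eq_lintegral_Ioo q.1.1 (by linarith) x).symm
  refine tendsto_lintegral_filter_of_dominated_convergence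
    ((Ioc 0 (2 / ε₀)).indicator fun _ => D) ?_ ?_ ?_ ?_
  · refine Eventually.of_forall fun q => Antitone.measurable fun s t hst => measure_mono ?_
    have : q.2 ^ 2 * s ≤ q.2 ^ 2 * t := by gcongr
    exact Ioo_subset_Ioo (by linarith) (by linarith)
  · filter_upwards [hpos, (continuous_fst.tendsto (m₀, ε₀)).eventually hev,
      (hsnd.const_sub x).eventually_const_lt ha, (hsnd.const_add x).eventually_lt_const hb]
      with q hq hmq hqa hqb
    filter_upwards [ae_restrict_mem measurableSet_Ioi] with t ht
    have hq0 : 0 < q.2 := by linarith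
    have ht0 : 0 < t := ht
    have hqt : 0 < q.2 ^ 2 * t := by positivity
    by_cases hmem : t ∈ Ioc 0 (2 / ε₀)
    · rw [indicator_of_mem hmem]
      refine (measure_mono (Ioo_subset_Icc_self.trans (Icc_subset_Icc ?_ ?_))).trans hmq.le
      · linarith
      · linarith
    · rw [indicator_of_notMem hmem]
      have ht' : 2 / ε₀ < t := by
        by_contra hle
        exact hmem ⟨ht, not_lt.1 hle⟩
      have h2 : 2 < t * ε₀ := (div_lt_iff₀ hε₀).1 ht'
      have h3 : 1 < q.2 * t := by nlinarith
      rw [Ioo_eq_empty (by nlinarith), measure_empty]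
  · refine ((setLIntegral_le_lintegral _ _).trans_lt ?_).ne
    rw [lintegral_indicator_const measurableSet_Ioc]
    exact ENNReal.mul_lt_top hDtop measure_Ioc_lt_top
  · have : IsFiniteMeasure (m₀.1.restrict (Icc (x - ε₀) (x + ε₀))) := ⟨by simpa using hfin⟩
    have hcount := Measure.countable_meas_level_set_pos
      (μ := m₀.1.restrict (Icc (x - ε₀) (x + ε₀)))
      (g := fun y => (ε₀ - |x - y|) / ε₀ ^ 2) (by fun_prop)
    filter_upwards [ae_restrict_mem measurableSet_Ioi, ae_restrict_of_ae (hcount.ae_notMem _)]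
      with t ht hnot
    refine tendsto_measure_Ioo (continuous_fst.tendsto (m₀, ε₀))
      (hsnd.sub ((hsnd.pow 2).mul_const t)) ?_
    have ht0 : 0 < t := ht
    have hεt : 0 < ε₀ ^ 2 * t := by positivity
    simp only [not_lt, nonpos_iff_eq_zero] at hnot
    rw [Measure.restrict_apply' measurableSet_Icc] at hnot
    refine measure_mono_null (fun y hy => ?_) hnot
    have hy' : |x - y| = ε₀ - ε₀ ^ 2 * t := hy
    have hle : |x - y| ≤ ε₀ := by linarith
    rw [abs_le] at hle
    refine ⟨?_, by linarith, by linarith⟩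
    show (ε₀ - |x - y|) / ε₀ ^ 2 = t
    rw [hy']
    field_simp
    ring

lemma tendsto_setLIntegral_truncDensity (hε₀ : 0 < ε₀) {A : Set ℝ} (hA : volume A ≠ ∞) :
    Tendsto (fun q : MR × ℝ => ∫⁻ x in A, truncDensity q.1.1 q.2 x) (𝓝 (m₀, ε₀))
      (𝓝 (∫⁻ x in A, truncDensity m₀.1 ε₀ x)) := by
  have hsnd : Tendsto (fun q : MR × ℝ => q.2) (𝓝 (m₀, ε₀)) (𝓝 ε₀) :=
    continuous_snd.tendsto (m₀, ε₀)
  have hheight : Tendsto (fun q : MR × ℝ => ENNReal.ofReal (1 / q.2 ^ 2)) (𝓝 (m₀, ε₀))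
      (𝓝 (ENNReal.ofReal (1 / ε₀ ^ 2))) :=
    ENNReal.tendsto_ofReal (tendsto_const_nhds.div (hsnd.pow 2) (by positivity))
  obtain ⟨C, hC, hCtop⟩ := exists_between (ENNReal.ofReal_lt_top (r := 1 / ε₀ ^ 2))
  refine tendsto_lintegral_filter_of_dominated_convergence (fun _ => C) ?_ ?_ ?_ ?_
  · exact Eventually.of_forall fun q => measurable_truncDensity _ _
  · filter_upwards [hheight.eventually_lt_const hC] with q hq
    exact Eventually.of_forall fun x => (truncDensity_le _ _ _).trans hq.le
  · rw [setLIntegral_const]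
    exact ENNReal.mul_ne_top hCtop.ne hA
  · filter_upwards [ae_restrict_of_ae
      ((countable_infDist_explosionSetR_eq m₀.1 hε₀).ae_notMem _)] with x hx
    refine Tendsto.min ?_ hheight
    by_cases hfin : m₀.1 (Icc (x - ε₀) (x + ε₀)) = ∞
    · simp only [not_and, not_forall, not_le] at hx
      obtain ⟨p, hp, hxp⟩ := hx hfin
      exact tendsto_mollify_of_explosion hε₀ hp hxp
    · exact tendsto_mollify_of_finite hε₀ (lt_top_iff_ne_top.2 hfin)

lemma tendsto_Hmeas_apply (hε₀ : 0 < ε₀) {A : Set ℝ} (hAm : MeasurableSet A)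
    (hA : volume A ≠ ∞) :
    Tendsto (fun q : MR × ℝ => Hmeas q.1.1 q.2 A) (𝓝 (m₀, ε₀)) (𝓝 (Hmeas m₀.1 ε₀ A)) := by
  simp only [Hmeas_apply _ _ hAm]
  have hfin : ∫⁻ x in A, truncDensity m₀.1 ε₀ x ≠ ∞ := by
    refine ((lintegral_mono fun x => truncDensity_le m₀.1 ε₀ x).trans_lt ?_).ne
    rw [setLIntegral_const]
    exact ENNReal.mul_lt_top ENNReal.ofReal_lt_top (lt_top_iff_ne_top.2 hA)
  exact ENNReal.Tendsto.mul
    (ENNReal.tendsto_ofReal ((continuous_snd.tendsto (m₀, ε₀)).const_sub 1)) (Or.inr hfin)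
    (tendsto_setLIntegral_truncDensity hε₀ hA) (Or.inr ENNReal.ofReal_ne_top)

end PositiveBandwidth

section SmallBandwidth

lemma mollify_restrict_eq {m : Measure ℝ} {S : Set ℝ} (hS : MeasurableSet S) {ε x : ℝ}
    (hε : 0 < ε) (h : ∀ y, |x - y| < ε → y ∈ S) : mollify (m.restrict S) ε x = mollify m ε x := by
  unfold mollify
  rw [← lintegral_indicator hS]
  refine lintegral_congr fun y => ?_
  by_cases hy : y ∈ S
  · rw [indicator_of_mem hy]
  · rw [indicator_of_notMem hy, rho_eq_zero hε (not_lt.1 fun hlt => hy (h y hlt)),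
      ENNReal.ofReal_zero]

lemma setLIntegral_mollify_swap (m : Measure ℝ) [IsFiniteMeasure m] (ε : ℝ) (A : Set ℝ) :
    ∫⁻ x in A, mollify m ε x = ∫⁻ y, (∫⁻ x in A, ENNReal.ofReal (rho ε (x - y))) ∂m := by
  unfold mollify
  refine lintegral_lintegral_swap ?_
  exact (ENNReal.continuous_ofReal.comp
    ((continuous_rho ε).comp (continuous_fst.sub continuous_snd))).measurable.aemeasurable

/-- Mollification at bandwidth `ε` moves mass by at most `ε`: upper bound. -/
lemma Hmeas_Icc_le {m : Measure ℝ} {ε a b a' b' : ℝ} (hε : 0 < ε) (ha : a' + ε ≤ a)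
    (hb : b + ε ≤ b') (hfin : m (Icc a' b') < ∞) : Hmeas m ε (Icc a b) ≤ m (Icc a' b') := by
  have : IsFiniteMeasure (m.restrict (Icc a' b')) := ⟨by simpa using hfin⟩
  rw [Hmeas_apply m ε measurableSet_Icc]
  calc ENNReal.ofReal (1 - ε) * ∫⁻ x in Icc a b, truncDensity m ε x
      ≤ 1 * ∫⁻ x in Icc a b, mollify (m.restrict (Icc a' b')) ε x := by
        refine mul_le_mul' (ENNReal.ofReal_le_one.2 (by linarith)) ?_
        refine setLIntegral_mono' measurableSet_Icc fun x hx => (min_le_left _ _).trans_eq ?_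
        refine (mollify_restrict_eq measurableSet_Icc hε fun y hy => ?_).symm
        rw [abs_lt] at hy
        exact ⟨by linarith [hx.1], by linarith [hx.2]⟩
    _ = ∫⁻ y in Icc a' b', (∫⁻ x in Icc a b, ENNReal.ofReal (rho ε (x - y))) ∂m := by
        rw [one_mul, setLIntegral_mollify_swap]
    _ ≤ ∫⁻ y in Icc a' b', 1 ∂m := lintegral_mono fun y =>
        (setLIntegral_le_lintegral _ _).trans_eq (lintegral_rho_sub hε y)
    _ = m (Icc a' b') := by rw [setLIntegral_one]

/-- Mollification at bandwidth `ε` moves mass by at most `ε`, and the truncation at height `1/ε²`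
retains mass at least `1/ε`: lower bound. -/
lemma min_le_setLIntegral_truncDensity {m : Measure ℝ} {ε a b a' b' : ℝ} (hε : 0 < ε)
    (ha : a ≤ a' - ε) (hb : b' + ε ≤ b) :
    min (m (Icc a' b')) (ENNReal.ofReal (1 / ε)) ≤ ∫⁻ x in Ioo a b, truncDensity m ε x := by
  have hsq : ENNReal.ofReal (1 / ε ^ 2) = ENNReal.ofReal (1 / ε) * ENNReal.ofReal (1 / ε) := by
    rw [← ENNReal.ofReal_mul (by positivity)]
    congr 1
    field_simp
  by_cases htop : m (Icc a' b') = ∞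
  · obtain ⟨p, hp, hpe⟩ := exists_mem_explosionSetR htop
    calc min (m (Icc a' b')) (ENNReal.ofReal (1 / ε))
        ≤ ENNReal.ofReal (1 / ε ^ 2) * volume (Ioo (p - ε) (p + ε)) := by
          refine (min_le_right _ _).trans ?_
          rw [Real.volume_Ioo, ← ENNReal.ofReal_mul (by positivity)]
          refine ENNReal.ofReal_le_ofReal ?_
          have : 1 / ε ^ 2 * (p + ε - (p - ε)) = 2 * (1 / ε) := by
            field_simp
            ring
          rw [this]
          have : 0 < 1 / ε := by positivity
          linarith
      _ = ∫⁻ x in Ioo (p - ε) (p + ε), ENNReal.ofReal (1 / ε ^ 2) := (setLIntegral_const _ _).symm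
      _ ≤ ∫⁻ x in Ioo (p - ε) (p + ε), truncDensity m ε x := by
          refine setLIntegral_mono' measurableSet_Ioo fun x hx => ?_
          have hxp : |x - p| < ε := abs_lt.2 ⟨by linarith [hx.1], by linarith [hx.2]⟩
          rw [truncDensity, mollify_eq_top hε hxp hpe, min_eq_right le_top]
      _ ≤ ∫⁻ x in Ioo a b, truncDensity m ε x :=
          lintegral_mono_set (Ioo_subset_Ioo (by linarith [hp.1]) (by linarith [hp.2]))
  · set M := m (Icc a' b') with hM
    rcases eq_or_ne M 0 with h0 | h0
    · rw [h0]
      exact (min_le_left _ _).trans zero_le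
    have : IsFiniteMeasure (m.restrict (Icc a' b')) :=
      ⟨by simpa using lt_top_iff_ne_top.2 htop⟩
    set ν := m.restrict (Icc a' b') with hν
    set c := min M (ENNReal.ofReal (1 / ε)) / M with hc
    have hcM : c * M = min M (ENNReal.ofReal (1 / ε)) := ENNReal.div_mul_cancel h0 htop
    have hνmass : ∫⁻ x in Ioo a b, mollify ν ε x = M := by
      rw [setLIntegral_mollify_swap, hM, ← setLIntegral_one]
      refine setLIntegral_congr_fun measurableSet_Icc fun y hy => ?_
      rw [← lintegral_rho_sub hε y, ← lintegral_indicator measurableSet_Ioo]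
      refine lintegral_congr fun x => ?_
      by_cases hx : x ∈ Ioo a b
      · rw [indicator_of_mem hx]
      · rw [indicator_of_notMem hx, rho_eq_zero hε, ENNReal.ofReal_zero]
        by_contra! hlt
        rw [abs_lt] at hlt
        exact hx ⟨by linarith [hy.1], by linarith [hy.2]⟩
    have hνle : ∀ x, mollify ν ε x ≤ ENNReal.ofReal (1 / ε) * M := by
      intro x
      calc mollify ν ε x ≤ ∫⁻ _, ENNReal.ofReal (1 / ε) ∂ν :=
            lintegral_mono fun y => ENNReal.ofReal_le_ofReal (rho_le hε _)
        _ = _ := by rw [hν, setLIntegral_const]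
    calc min M (ENNReal.ofReal (1 / ε)) = c * ∫⁻ x in Ioo a b, mollify ν ε x := by
          rw [hνmass, hcM]
      _ = ∫⁻ x in Ioo a b, c * mollify ν ε x :=
          (lintegral_const_mul _ (lowerSemicontinuous_mollify ν ε).measurable).symm
      _ ≤ ∫⁻ x in Ioo a b, truncDensity m ε x := by
          refine lintegral_mono fun x => le_min ?_ ?_
          · calc c * mollify ν ε x ≤ 1 * mollify m ε x := by
                  refine mul_le_mul' (ENNReal.div_le_of_le_mul ?_) (setLIntegral_le_lintegral _ _)
                  rw [one_mul]
                  exact min_le_left _ _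
              _ = _ := one_mul _
          · calc c * mollify ν ε x ≤ c * (ENNReal.ofReal (1 / ε) * M) := by
                  gcongr
                  exact hνle x
              _ = ENNReal.ofReal (1 / ε) * min M (ENNReal.ofReal (1 / ε)) := by
                  rw [← hcM]
                  ring
              _ ≤ _ := by
                  rw [hsq]
                  gcongr
                  exact min_le_right _ _

end SmallBandwidth

section Homotopy

/-- The homotopy `H(m, ε)`, with value `m` for `ε ≤ 0`. -/
def mollifyHomotopy (m : MR) (ε : ℝ) : MR :=
  if 0 < ε then ⟨Hmeas m.1 ε, isRegularM_Hmeas m.1 ε⟩ else m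

lemma mollifyHomotopy_zero (m : MR) : mollifyHomotopy m 0 = m := if_neg (lt_irrefl _)

lemma mollifyHomotopy_of_pos (m : MR) {ε : ℝ} (hε : 0 < ε) :
    (mollifyHomotopy m ε).1 = Hmeas m.1 ε := by
  rw [mollifyHomotopy, if_pos hε]

lemma eventually_lt_mollifyHomotopy_zero {m₀ : MR} {a b : ℝ} {c : ℝ≥0∞}
    (h : c < m₀.1 (Ioo a b)) :
    ∀ᶠ q : MR × ℝ in 𝓝 (m₀, 0), 0 ≤ q.2 → c < (mollifyHomotopy q.1 q.2).1 (Ioo a b) := by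
  obtain ⟨c', hcc', hc'⟩ := exists_between h
  obtain ⟨a', b', ha, -, hb, hev⟩ := exists_eventually_lt_measure_Ioo m₀ hc'
  have hc'top : c' < ∞ := hc'.trans_le le_top
  have hsnd : Tendsto (fun q : MR × ℝ => q.2) (𝓝 (m₀, 0)) (𝓝 0) :=
    continuous_snd.tendsto (m₀, (0 : ℝ))
  have hfactor : Tendsto (fun q : MR × ℝ => ENNReal.ofReal (1 - q.2) * c') (𝓝 (m₀, 0)) (𝓝 c') := by
    have h₁ := ENNReal.Tendsto.mul_const (b := c')
      (ENNReal.tendsto_ofReal (hsnd.const_sub 1)) (Or.inr hc'top.ne)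
    simpa using h₁
  have hK : 0 < 1 / (c'.toReal + 1) := by positivity
  filter_upwards [(continuous_fst.tendsto (m₀, (0 : ℝ))).eventually hev,
    hfactor.eventually_const_lt hcc', hsnd.eventually_lt_const (sub_pos.2 ha),
    hsnd.eventually_lt_const (sub_pos.2 hb), hsnd.eventually_lt_const hK]
    with q hq hfac hqa hqb hqK hq0
  rcases hq0.eq_or_lt with h0 | hpos
  · rw [← h0, mollifyHomotopy_zero]
    exact hcc'.trans (hq.trans_le (measure_mono (Ioo_subset_Ioo ha.le hb.le)))
  · rw [mollifyHomotopy_of_pos _ hpos, Hmeas_apply _ _ measurableSet_Ioo]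
    refine hfac.trans_le ?_
    gcongr
    refine le_trans (le_min (hq.le.trans (measure_mono Ioo_subset_Icc_self)) ?_)
      (min_le_setLIntegral_truncDensity hpos (by linarith) (by linarith))
    refine ENNReal.le_ofReal_iff_toReal_le hc'top.ne (by positivity) |>.2 ?_
    rw [le_div_iff₀ hpos]
    have h1 := (lt_div_iff₀ (by positivity)).1 hqK
    nlinarith

lemma eventually_mollifyHomotopy_zero_lt {m₀ : MR} {a b : ℝ} (hab : a ≤ b) {d : ℝ≥0∞}
    (h : m₀.1 (Icc a b) < d) :
    ∀ᶠ q : MR × ℝ in 𝓝 (m₀, 0), 0 ≤ q.2 → (mollifyHomotopy q.1 q.2).1 (Icc a b) < d := by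
  obtain ⟨a', b', ha, hb, -, hev⟩ := exists_eventually_measure_Icc_lt m₀ hab h
  have hsnd : Tendsto (fun q : MR × ℝ => q.2) (𝓝 (m₀, 0)) (𝓝 0) :=
    continuous_snd.tendsto (m₀, (0 : ℝ))
  filter_upwards [(continuous_fst.tendsto (m₀, (0 : ℝ))).eventually hev,
    hsnd.eventually_lt_const (sub_pos.2 ha), hsnd.eventually_lt_const (sub_pos.2 hb)]
    with q hq hqa hqb hq0
  rcases hq0.eq_or_lt with h0 | hpos
  · rw [← h0, mollifyHomotopy_zero]
    exact (measure_mono (Icc_subset_Icc ha.le hb.le)).trans_lt hq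
  · rw [mollifyHomotopy_of_pos _ hpos]
    exact (Hmeas_Icc_le hpos (by linarith) (by linarith) (hq.trans_le le_top)).trans_lt hq

lemma tendsto_mollifyHomotopy_apply {m₀ : MR} {ε₀ : ℝ} (hε₀ : 0 < ε₀) {A : Set ℝ}
    (hAm : MeasurableSet A) (hA : volume A ≠ ∞) :
    Tendsto (fun q : MR × ℝ => (mollifyHomotopy q.1 q.2).1 A) (𝓝 (m₀, ε₀))
      (𝓝 ((mollifyHomotopy m₀ ε₀).1 A)) := by
  rw [mollifyHomotopy_of_pos m₀ hε₀]
  refine (tendsto_Hmeas_apply hε₀ hAm hA).congr' ?_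
  filter_upwards [(continuous_snd.tendsto (m₀, ε₀)).eventually_const_lt hε₀] with q hq
  rw [mollifyHomotopy_of_pos _ hq]

lemma continuous_mollifyHomotopy :
    Continuous fun p : MR × Icc (0 : ℝ) 1 => mollifyHomotopy p.1 (p.2 : ℝ) := by
  have hcoe : Continuous fun p : MR × Icc (0 : ℝ) 1 => (p.1, (p.2 : ℝ)) := by fun_prop
  refine continuous_induced_rng.2 (continuous_generateFrom_iff.2 ?_)
  rintro U (⟨a, b, c, hab, rfl⟩ | ⟨a, b, d, hab, rfl⟩) <;>
  · refine isOpen_iff_mem_nhds.2 ?_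
    rintro ⟨m₀, ε₀, hε₀⟩ hmem
    rcases hε₀.1.eq_or_lt with rfl | hpos
    · simp only [mem_preimage, Function.comp_apply, mem_ofPred_eq, mollifyHomotopy_zero] at hmem
      first
        | filter_upwards [(hcoe.tendsto (m₀, ⟨0, hε₀⟩)).eventually
            (eventually_lt_mollifyHomotopy_zero hmem)] with q hq using hq q.2.2.1
        | filter_upwards [(hcoe.tendsto (m₀, ⟨0, hε₀⟩)).eventually
            (eventually_mollifyHomotopy_zero_lt hab hmem)] with q hq using hq q.2.2.1
    · first
        | exact ((tendsto_mollifyHomotopy_apply hpos measurableSet_Ioo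
            measure_Ioo_lt_top.ne).comp (hcoe.tendsto (m₀, ⟨ε₀, hε₀⟩))).eventually_const_lt hmem
        | exact ((tendsto_mollifyHomotopy_apply hpos measurableSet_Icc
            measure_Icc_lt_top.ne).comp (hcoe.tendsto (m₀, ⟨ε₀, hε₀⟩))).eventually_lt_const hmem

lemma mollifyHomotopy_one (m : MR) : (mollifyHomotopy m 1).1 = 0 := by
  rw [mollifyHomotopy_of_pos _ one_pos, Hmeas_one]

lemma contractibleSpace_MR : ContractibleSpace MR := by
  have hreg : IsRegularM (0 : Measure ℝ) := isRegularM_of_isLocallyFiniteMeasure 0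
  refine (contractible_iff_id_nullhomotopic MR).2 ⟨⟨0, hreg⟩, ⟨?_⟩⟩
  exact
    { toFun := fun p => mollifyHomotopy p.2 (p.1 : ℝ)
      continuous_toFun := continuous_mollifyHomotopy.comp continuous_swap
      map_zero_left := fun m => mollifyHomotopy_zero m
      map_one_left := fun m => Subtype.ext (mollifyHomotopy_one m) }

end Homotopy

/-- The homotopy `H(m, 0) = m`, `H(m, ε) = (1−ε)·min(ρ_ε * m, 1/ε²)·λ` for
`ε ∈ (0,1]` is a continuous map `M(ℝ) × [0,1] → M(ℝ)` with `H(m,1) = 0` whose values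
for `ε > 0` are locally finite measures, absolutely continuous with bounded density.
In particular `M(ℝ)` is contractible and `M_loc(ℝ)` is homotopy dense in `M(ℝ)`. -/
theorem stmt_14 :
    ∃ H : MR → ℝ → MR,
      (∀ m : MR, H m 0 = m) ∧
      (∀ m : MR, (H m 1).1 = 0) ∧
      (∀ (m : MR) (ε : ℝ), 0 < ε → ε ≤ 1 → (H m ε).1 = Hmeas m.1 ε) ∧
      (∀ (m : MR) (ε : ℝ), 0 < ε → ε ≤ 1 →
        (H m ε).1 ≪ volume ∧
        (∃ Cb : ℝ≥0∞, Cb < ∞ ∧ ∀ A : Set ℝ, MeasurableSet A →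
            (H m ε).1 A ≤ Cb * volume A) ∧
        explosionSetR (H m ε).1 = ∅) ∧
      Continuous (fun p : MR × Set.Icc (0 : ℝ) 1 => H p.1 (p.2 : ℝ)) ∧
      ContractibleSpace MR := by
  refine ⟨mollifyHomotopy, mollifyHomotopy_zero, mollifyHomotopy_one,
    fun m ε hε _ => mollifyHomotopy_of_pos m hε, fun m ε hε _ => ?_,
    continuous_mollifyHomotopy, contractibleSpace_MR⟩
  rw [mollifyHomotopy_of_pos m hε]
  exact ⟨Hmeas_absolutelyContinuous m.1 ε,
    ⟨_, ENNReal.mul_lt_top ENNReal.ofReal_lt_top ENNReal.ofReal_lt_top,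
      fun A hA => Hmeas_le m.1 ε hA⟩, explosionSetR_Hmeas m.1 ε⟩
end
end
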